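/- Let F = (P,Q) be a Keller map which is not proper (i.e. there exists a sequence (b_i) in ℂ² with ‖b_i‖ → ∞ such that (F(b_i)) converges in ℂ²). Then the non-proper value set A_F is nonempty, and for every point a ∈ A_F there exist nonconstant polynomials α, β ∈ ℂ[t] such that a lies in the image of the map t ↦ (α(t), β(t)), this image is contained in A_F, and (deg α)·(deg Q) = (deg β)·(deg P). -/

import Mathlib

open MvPolynomial Filter

/-- Evaluation of a bivariate polynomial at a point of `ℂ × ℂ`. -/
noncomputable def evalPoly (P : MvPolynomial (Fin 2) ℂ) (p : ℂ × ℂ) : ℂ :=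
  MvPolynomial.eval ![p.1, p.2] P

/-- The polynomial map `ℂ² → ℂ²` given by a pair of polynomials. -/
noncomputable def polyMap (P Q : MvPolynomial (Fin 2) ℂ) (p : ℂ × ℂ) : ℂ × ℂ :=
  (evalPoly P p, evalPoly Q p)

/-- `(P, Q)` is a Keller map: the Jacobian determinant is a nonzero constant. -/
def IsKeller (P Q : MvPolynomial (Fin 2) ℂ) : Prop :=
  ∃ c : ℂ, c ≠ 0 ∧
    pderiv 0 P * pderiv 1 Q - pderiv 1 P * pderiv 0 Q = MvPolynomial.C c

/-- `P` is a rational polynomial: away from finitely many values `c`, the fiber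
`P = c` is homeomorphic to `ℂ` minus a finite set of points. -/
def IsRationalPoly (P : MvPolynomial (Fin 2) ℂ) : Prop :=
  ∃ S : Finset ℂ, ∀ c ∉ S, ∃ T : Finset ℂ,
    Nonempty ({p : ℂ × ℂ // evalPoly P p = c} ≃ₜ {z : ℂ // z ∉ T})

/-- The polynomial map `(P, Q)` has a polynomial inverse. -/
def IsInvertible (P Q : MvPolynomial (Fin 2) ℂ) : Prop :=
  ∃ A B : MvPolynomial (Fin 2) ℂ,
    polyMap A B ∘ polyMap P Q = id ∧ polyMap P Q ∘ polyMap A B = id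

/-- The non-proper value set of a map `F : ℂ² → ℂ²`. -/
def nonProperSet (F : ℂ × ℂ → ℂ × ℂ) : Set (ℂ × ℂ) :=
  {a | ∃ b : ℕ → ℂ × ℂ,
    Tendsto (fun i => ‖b i‖) atTop atTop ∧ Tendsto (fun i => F (b i)) atTop (nhds a)}

section Weighted

theorem eq_sum_C_mul_X (p : MvPolynomial (Fin 2) ℂ) :
    p = ∑ m ∈ p.support, C (coeff m p) * X 0 ^ m 0 * X 1 ^ m 1 := by
  conv_lhs => rw [p.as_sum]
  refine Finset.sum_congr rfl fun m _ => ?_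
  rw [monomial_eq, Finsupp.prod_fintype _ _ (by simp), Fin.prod_univ_two, mul_assoc]

/-- The weighted transform `τ ^ (-K) * p (τ ^ a, τ ^ b * w)` of `p`, as a polynomial in `(τ, w)`. -/
noncomputable def weighted (a b K : ℤ) (p : MvPolynomial (Fin 2) ℂ) : MvPolynomial (Fin 2) ℂ :=
  ∑ m ∈ p.support, C (coeff m p) * X 0 ^ (a * m 0 + b * m 1 - K).toNat * X 1 ^ m 1

theorem evalPoly_eq_sum (p : MvPolynomial (Fin 2) ℂ) (t u : ℂ) :
    evalPoly p (t, u) = ∑ m ∈ p.support, coeff m p * t ^ m 0 * u ^ m 1 := by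
  conv_lhs => rw [eq_sum_C_mul_X p]
  simp [evalPoly]

theorem evalPoly_pderiv_one_eq_sum (p : MvPolynomial (Fin 2) ℂ) (t u : ℂ) :
    evalPoly (pderiv 1 p) (t, u) =
      ∑ m ∈ p.support, coeff m p * t ^ m 0 * (m 1 * u ^ (m 1 - 1)) := by
  conv_lhs => rw [eq_sum_C_mul_X p]
  simp [evalPoly, pderiv_X, Derivation.leibniz_pow]

theorem evalPoly_pderiv_zero_eq_sum (p : MvPolynomial (Fin 2) ℂ) (t u : ℂ) :
    evalPoly (pderiv 0 p) (t, u) =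
      ∑ m ∈ p.support, coeff m p * (m 0 * t ^ (m 0 - 1)) * u ^ m 1 := by
  conv_lhs => rw [eq_sum_C_mul_X p]
  simp [evalPoly, pderiv_X, Derivation.leibniz_pow]
  refine Finset.sum_congr rfl fun m _ => by ring

theorem evalPoly_weighted_eq_sum (a b K : ℤ) (p : MvPolynomial (Fin 2) ℂ) (t u : ℂ) :
    evalPoly (weighted a b K p) (t, u) =
      ∑ m ∈ p.support, coeff m p * t ^ (a * m 0 + b * m 1 - K).toNat * u ^ m 1 := by
  simp [evalPoly, weighted]

variable {a b K : ℤ} {p : MvPolynomial (Fin 2) ℂ}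

theorem monomial_weighted {a b K : ℤ} {j k : ℕ} (h : K ≤ a * j + b * k) {τ : ℂ} (hτ : τ ≠ 0)
    (w : ℂ) :
    τ ^ (a * j + b * k - K).toNat * w ^ k * τ ^ K = (τ ^ a) ^ j * (τ ^ b * w) ^ k := by
  rw [← zpow_natCast τ (a * j + b * k - K).toNat, Int.toNat_of_nonneg (by lia), mul_pow,
    mul_right_comm, ← zpow_add₀ hτ, sub_add_cancel, zpow_add₀ hτ, zpow_mul, zpow_mul,
    zpow_natCast, zpow_natCast, mul_assoc]

theorem natCast_mul_pow_pred (x : ℂ) (k : ℕ) : x * (k * x ^ (k - 1)) = k * x ^ k := by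
  cases k with
  | zero => simp
  | succ k => simp; ring

theorem evalPoly_weighted (h : ∀ m ∈ p.support, K ≤ a * m 0 + b * m 1) {τ : ℂ} (hτ : τ ≠ 0)
    (w : ℂ) :
    evalPoly (weighted a b K p) (τ, w) * τ ^ K = evalPoly p (τ ^ a, τ ^ b * w) := by
  rw [evalPoly_weighted_eq_sum, evalPoly_eq_sum, Finset.sum_mul]
  refine Finset.sum_congr rfl fun m hm => ?_
  rw [mul_assoc _ ((τ ^ a) ^ _), ← monomial_weighted (h m hm) hτ]
  ring

theorem evalPoly_pderiv_one_weighted (h : ∀ m ∈ p.support, K ≤ a * m 0 + b * m 1) {τ : ℂ}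
    (hτ : τ ≠ 0) (w : ℂ) :
    evalPoly (pderiv 1 (weighted a b K p)) (τ, w) * τ ^ K =
      τ ^ b * evalPoly (pderiv 1 p) (τ ^ a, τ ^ b * w) := by
  rw [evalPoly_pderiv_one_eq_sum p, Finset.mul_sum, weighted]
  simp only [evalPoly, map_sum, Finset.sum_mul]
  refine Finset.sum_congr rfl fun m hm => ?_
  simp [pderiv_X, Derivation.leibniz_pow]
  rcases hk : m 1 with _ | k
  · simp
  · have := monomial_weighted (K := K - b) (j := m 0) (k := k) (a := a) (b := b)
      (by have := h m hm; rw [hk] at this; push_cast at this; linarith) hτ w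
    rw [show a * (m 0 : ℤ) + b * k - (K - b) = a * m 0 + b * (k + 1 : ℕ) - K by push_cast; ring,
      zpow_sub₀ hτ, mul_div_assoc', div_eq_iff (zpow_ne_zero _ hτ)] at this
    simp only [Nat.add_sub_cancel]
    push_cast at this ⊢
    linear_combination (coeff m p * (k + 1)) * this

theorem evalPoly_pderiv_zero_weighted (h : ∀ m ∈ p.support, K ≤ a * m 0 + b * m 1) {τ : ℂ}
    (hτ : τ ≠ 0) (w : ℂ) :
    (τ * evalPoly (pderiv 0 (weighted a b K p)) (τ, w) +
        K * evalPoly (weighted a b K p) (τ, w)) * τ ^ K =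
      a * (τ ^ a * evalPoly (pderiv 0 p) (τ ^ a, τ ^ b * w)) +
      b * (τ ^ b * w * evalPoly (pderiv 1 p) (τ ^ a, τ ^ b * w)) := by
  rw [evalPoly_pderiv_zero_eq_sum p, evalPoly_pderiv_one_eq_sum p, evalPoly_weighted_eq_sum,
    weighted]
  simp only [evalPoly, map_sum, Finset.sum_mul, Finset.mul_sum, ← Finset.sum_add_distrib]
  refine Finset.sum_congr rfl fun m hm => ?_
  simp [pderiv_X, Derivation.leibniz_pow]
  have hm' := monomial_weighted (h m hm) hτ w
  have he : (((a * m 0 + b * m 1 - K).toNat : ℤ) : ℂ) = a * m 0 + b * m 1 - K := by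
    rw [Int.toNat_of_nonneg (by have := h m hm; lia)]
    push_cast; ring
  rw [Int.cast_natCast] at he
  have h1 := natCast_mul_pow_pred τ (a * m 0 + b * m 1 - K).toNat
  have h2 := natCast_mul_pow_pred (τ ^ a) (m 0)
  have h3 := natCast_mul_pow_pred (τ ^ b * w) (m 1)
  rw [he] at h1 ⊢
  linear_combination coeff m p * w ^ m 1 * τ ^ K * h1 - coeff m p * a * (τ ^ b * w) ^ m 1 * h2 -
    coeff m p * b * (τ ^ a) ^ m 0 * h3 + coeff m p * (a * m 0 + b * m 1) * hm'

/-- `t ^ (A + B + 1)` times the Jacobian determinant of `(t ^ (-A) * p, t ^ (-B) * q)`. -/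
noncomputable def twistedJac (p q : MvPolynomial (Fin 2) ℂ) (A B : ℤ) (t u : ℂ) : ℂ :=
  (t * evalPoly (pderiv 0 p) (t, u) - A * evalPoly p (t, u)) * evalPoly (pderiv 1 q) (t, u) -
    evalPoly (pderiv 1 p) (t, u) * (t * evalPoly (pderiv 0 q) (t, u) - B * evalPoly q (t, u))

/-- Off `t = 0`, the twisted Jacobian is independent of the second variable. -/
def JacIndep (p q : MvPolynomial (Fin 2) ℂ) (A B : ℤ) : Prop :=
  ∀ t, t ≠ 0 → ∀ u u', twistedJac p q A B t u = twistedJac p q A B t u'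

theorem JacIndep.weighted {q : MvPolynomial (Fin 2) ℂ} {L A B : ℤ} (hg : JacIndep p q A B)
    (hp : ∀ m ∈ p.support, K ≤ a * m 0 + b * m 1) (hq : ∀ m ∈ q.support, L ≤ a * m 0 + b * m 1) :
    JacIndep (weighted a b K p) (weighted a b L q) (a * A - K) (a * B - L) := by
  intro τ hτ
  have key : ∀ w, τ ^ K * τ ^ L *
      twistedJac (_root_.weighted a b K p) (_root_.weighted a b L q) (a * A - K) (a * B - L) τ w =
      a * τ ^ b * twistedJac p q A B (τ ^ a) (τ ^ b * w) := by
    intro w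
    have p0 := evalPoly_weighted hp hτ w
    have p1 := evalPoly_pderiv_one_weighted hp hτ w
    have p2 := evalPoly_pderiv_zero_weighted hp hτ w
    have q0 := evalPoly_weighted hq hτ w
    have q1 := evalPoly_pderiv_one_weighted hq hτ w
    have q2 := evalPoly_pderiv_zero_weighted hq hτ w
    set x := τ ^ K
    set y := τ ^ L
    simp only [twistedJac]
    push_cast
    generalize evalPoly (pderiv 0 (_root_.weighted a b K p)) (τ, w) = P2 at *
    generalize evalPoly (pderiv 1 (_root_.weighted a b K p)) (τ, w) = P1 at *
    generalize evalPoly (_root_.weighted a b K p) (τ, w) = P0 at *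
    generalize evalPoly (pderiv 0 (_root_.weighted a b L q)) (τ, w) = Q2 at *
    generalize evalPoly (pderiv 1 (_root_.weighted a b L q)) (τ, w) = Q1 at *
    generalize evalPoly (_root_.weighted a b L q) (τ, w) = Q0 at *
    rw [← p0, ← q0]
    have : x * y * ((τ * P2 - (a * A - K) * P0) * Q1 - P1 * (τ * Q2 - (a * B - L) * Q0)) =
        ((τ * P2 + K * P0) * x - a * A * (P0 * x)) * (Q1 * y) -
        (P1 * x) * ((τ * Q2 + L * Q0) * y - a * B * (Q0 * y)) := by ring
    rw [this, p1, p2, q1, q2]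
    ring
  intro w w'
  have h := (key w).trans
    ((congrArg _ (hg _ (zpow_ne_zero a hτ) _ _)).trans (key w').symm)
  exact mul_left_cancel₀ (mul_ne_zero (zpow_ne_zero K hτ) (zpow_ne_zero L hτ)) h

end Weighted

section Slice

/-- The restriction of `p` to the line where the first variable vanishes. -/
noncomputable def slice (p : MvPolynomial (Fin 2) ℂ) : Polynomial ℂ :=
  aeval ![0, Polynomial.X] p

theorem eval_slice (p : MvPolynomial (Fin 2) ℂ) (u : ℂ) :
    (slice p).eval u = evalPoly p (0, u) := by
  induction p using MvPolynomial.induction_on with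
  | C a => simp [slice, evalPoly]
  | add p q hp hq => simp_all [slice, evalPoly]
  | mul_X p i hp =>
    fin_cases i <;> simp_all [slice, evalPoly]

theorem derivative_slice (p : MvPolynomial (Fin 2) ℂ) :
    Polynomial.derivative (slice p) = slice (pderiv 1 p) := by
  induction p using MvPolynomial.induction_on with
  | C a => simp [slice]
  | add p q hp hq => simp_all [slice]
  | mul_X p i hp =>
    fin_cases i <;> simp_all [slice, pderiv_X]
    ring

theorem coeff_C_mul_zero_pow_mul_X_pow (c : ℂ) (e l k : ℕ) :
    (Polynomial.C c * 0 ^ e * Polynomial.X ^ l : Polynomial ℂ).coeff k =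
      if e = 0 ∧ l = k then c else 0 := by
  rcases eq_or_ne e 0 with rfl | he
  · simp [Polynomial.coeff_X_pow, eq_comm]
  · simp [he]

theorem coeff_slice_weighted (a b K : ℤ) (p : MvPolynomial (Fin 2) ℂ) (k : ℕ) :
    (slice (weighted a b K p)).coeff k =
      ∑ m ∈ p.support,
        if (a * m 0 + b * m 1 - K).toNat = 0 ∧ m 1 = k then coeff m p else 0 := by
  simp only [slice, weighted, map_sum, Polynomial.finsetSum_coeff, ← coeff_C_mul_zero_pow_mul_X_pow]
  simp

theorem coeff_slice (p : MvPolynomial (Fin 2) ℂ) (k : ℕ) :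
    (slice p).coeff k = coeff (Finsupp.single 1 k) p := by
  have h : (slice p).coeff k = ∑ m ∈ p.support, if m 0 = 0 ∧ m 1 = k then coeff m p else 0 := by
    conv_lhs => rw [eq_sum_C_mul_X p]
    simp only [slice, map_sum, Polynomial.finsetSum_coeff, ← coeff_C_mul_zero_pow_mul_X_pow]
    simp
  rw [h, Finset.sum_eq_single (Finsupp.single 1 k)]
  · simp
  · rintro m - hm
    rw [if_neg]
    rintro ⟨h0, h1⟩
    exact hm (by ext i; fin_cases i <;> simp [h0, h1])
  · simp +contextual

/-- The translate `p (t, v + c)` of `p`. -/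
noncomputable def shift (c : ℂ) (p : MvPolynomial (Fin 2) ℂ) : MvPolynomial (Fin 2) ℂ :=
  aeval ![X 0, X 1 + C c] p

theorem evalPoly_shift (c : ℂ) (p : MvPolynomial (Fin 2) ℂ) (t v : ℂ) :
    evalPoly (shift c p) (t, v) = evalPoly p (t, v + c) := by
  induction p using MvPolynomial.induction_on with
  | C a => simp [shift, evalPoly]
  | add p q hp hq => simp_all [shift, evalPoly]
  | mul_X p i hp =>
    fin_cases i <;> simp_all [shift, evalPoly]

theorem pderiv_shift (c : ℂ) (p : MvPolynomial (Fin 2) ℂ) (i : Fin 2) :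
    pderiv i (shift c p) = shift c (pderiv i p) := by
  induction p using MvPolynomial.induction_on with
  | C a => simp [shift]
  | add p q hp hq => simp_all [shift]
  | mul_X p j hp =>
    fin_cases i <;> fin_cases j <;> simp_all [shift, pderiv_X]

theorem slice_shift (c : ℂ) (p : MvPolynomial (Fin 2) ℂ) :
    slice (shift c p) = (slice p).comp (Polynomial.X + Polynomial.C c) := by
  refine Polynomial.funext fun v => ?_
  simp [eval_slice, evalPoly_shift]

theorem continuous_evalPoly (p : MvPolynomial (Fin 2) ℂ) : Continuous (evalPoly p) := by
  have : Continuous fun x : ℂ × ℂ => (![x.1, x.2] : Fin 2 → ℂ) := by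
    refine continuous_pi fun i => ?_
    fin_cases i
    · exact continuous_fst
    · exact continuous_snd
  exact (MvPolynomial.continuous_eval p).comp this

theorem continuous_evalPoly_left (p : MvPolynomial (Fin 2) ℂ) (u : ℂ) :
    Continuous fun t => evalPoly p (t, u) :=
  (continuous_evalPoly p).comp (by fun_prop)

theorem JacIndep.zero {p q : MvPolynomial (Fin 2) ℂ} {A B : ℤ} (h : JacIndep p q A B) (u u' : ℂ) :
    twistedJac p q A B 0 u = twistedJac p q A B 0 u' := by
  have hc : ∀ u, Continuous fun t => twistedJac p q A B t u := fun u => by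
    have := continuous_evalPoly_left
    unfold twistedJac
    fun_prop
  have := Continuous.ext_on (dense_compl_singleton (0 : ℂ)) (hc u) (hc u')
    (fun t ht => h t ht u u')
  exact congrFun this 0

theorem X_sub_C_mul_derivative (f : Polynomial ℂ) (c : ℂ) (k : ℕ) :
    (Polynomial.X - Polynomial.C c) *
        Polynomial.derivative ((Polynomial.X - Polynomial.C c) ^ k * f) =
      (Polynomial.X - Polynomial.C c) ^ k *
        ((k : Polynomial ℂ) * f + (Polynomial.X - Polynomial.C c) * Polynomial.derivative f) := by
  cases k with
  | zero => simp
  | succ k => simp [Polynomial.derivative_mul, Polynomial.derivative_X_sub_C_pow]; ring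

theorem rootMultiplicity_ratio {f g : Polynomial ℂ} (hf : f ≠ 0) (hg : g ≠ 0) {A B : ℤ} (c : ℂ)
    (h : A * f * Polynomial.derivative g = B * Polynomial.derivative f * g) :
    A * g.rootMultiplicity c = B * f.rootMultiplicity c := by
  obtain ⟨f₁, hf₁, hfd⟩ := Polynomial.exists_eq_pow_rootMultiplicity_mul_and_not_dvd f hf c
  obtain ⟨g₁, hg₁, hgd⟩ := Polynomial.exists_eq_pow_rootMultiplicity_mul_and_not_dvd g hg c
  set k := f.rootMultiplicity c
  set l := g.rootMultiplicity c
  have h1 := X_sub_C_mul_derivative f₁ c k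
  have h2 := X_sub_C_mul_derivative g₁ c l
  rw [← hf₁] at h1
  rw [← hg₁] at h2
  rw [Polynomial.dvd_iff_isRoot, Polynomial.IsRoot.def] at hfd hgd
  set Y := Polynomial.X - Polynomial.C c with hY
  have hY0 : Y ≠ 0 := Polynomial.X_sub_C_ne_zero c
  have h3 : Y ^ k * Y ^ l * (A * f₁ * (l * g₁ + Y * Polynomial.derivative g₁)) =
      Y ^ k * Y ^ l * (B * (k * f₁ + Y * Polynomial.derivative f₁) * g₁) := by
    linear_combination Y * h + A * f * -h2 + B * g * h1 -
      A * Y ^ l * (l * g₁ + Y * Polynomial.derivative g₁) * hf₁ +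
      B * Y ^ k * (k * f₁ + Y * Polynomial.derivative f₁) * hg₁
  have h4 := congrArg (Polynomial.eval c) (mul_left_cancel₀ (by positivity) h3)
  simp [hY] at h4
  have h5 : f₁.eval c * g₁.eval c * (A * l - B * k) = 0 := by linear_combination h4
  have h6 : ((A * l - B * k : ℤ) : ℂ) = 0 := by
    push_cast
    exact (mul_eq_zero.mp h5).resolve_left (mul_ne_zero hfd hgd)
  have := Int.cast_eq_zero.mp h6
  lia

theorem JacIndep.rootMultiplicity {p q : MvPolynomial (Fin 2) ℂ} {A B : ℤ} (h : JacIndep p q A B)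
    (hp : slice p ≠ 0) (hq : slice q ≠ 0) {c : ℂ} (hpc : (slice p).eval c = 0)
    (hqc : (slice q).eval c = 0) :
    A * (slice q).rootMultiplicity c = B * (slice p).rootMultiplicity c := by
  refine rootMultiplicity_ratio hp hq c (Polynomial.funext fun u => ?_)
  have := h.zero u c
  simp only [twistedJac, ← eval_slice, hpc, hqc] at this
  simp [derivative_slice]
  linear_combination -this

end Slice

section NewtonSlope

theorem exists_min_slope (T : Finset (ℕ × ℕ)) (hT : T.Nonempty) (hpos : ∀ x ∈ T, 0 < x.1 ∧ 0 < x.2) :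
    ∃ s n : ℕ, 0 < s ∧ 0 < n ∧ n.Coprime s ∧ (∀ x ∈ T, n * x.2 ≤ s * x.1) ∧
      ∃ x ∈ T, n * x.2 = s * x.1 := by
  obtain ⟨⟨x, y⟩, hxy, hmin⟩ := T.exists_min_image (fun x => (x.1 / x.2 : ℚ)) hT
  obtain ⟨hx, hy⟩ := hpos _ hxy
  simp only at hx hy hmin
  have hg : 0 < x.gcd y := Nat.gcd_pos_of_pos_left _ hx
  obtain ⟨n, s, hc, h1, h2⟩ := Nat.exists_coprime x y
  have hn : 0 < n := Nat.pos_of_mul_pos_right (h1 ▸ hx)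
  have hs : 0 < s := Nat.pos_of_mul_pos_right (h2 ▸ hy)
  refine ⟨s, n, hs, hn, hc, fun z hz => ?_, (x, y), hxy, ?_⟩
  · have := hmin z hz
    have hz2 := (hpos z hz).2
    rw [div_le_div_iff₀ (by exact_mod_cast hy) (by exact_mod_cast hz2)] at this
    have h3 : x * z.2 ≤ z.1 * y := by exact_mod_cast this
    generalize x.gcd y = g at *
    subst h1 h2
    exact Nat.le_of_mul_le_mul_left (by linarith) hg
  · generalize x.gcd y = g at *
    subst h1 h2
    ring

variable {a b K : ℤ} {p : MvPolynomial (Fin 2) ℂ}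

theorem coeff_slice_weighted_of_mem (ha : a ≠ 0) (h : ∀ m ∈ p.support, K ≤ a * m 0 + b * m 1)
    {m : Fin 2 →₀ ℕ} (hm : m ∈ p.support) (hmK : a * m 0 + b * m 1 = K) :
    (slice (weighted a b K p)).coeff (m 1) = coeff m p := by
  rw [coeff_slice_weighted, Finset.sum_eq_single m]
  · simp [hmK]
  · intro m' hm' hne
    rw [if_neg]
    rintro ⟨h0, h1⟩
    have h2 : a * m' 0 + b * m' 1 = K := by
      have := h m' hm'
      have := Int.toNat_eq_zero.mp h0
      lia
    rw [h1] at h2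
    have h3 : (m' 0 : ℤ) = m 0 := mul_left_cancel₀ ha (by linarith)
    exact hne (by ext i; fin_cases i <;> simp_all)
  · simp [hm]

theorem exists_mem_of_coeff_slice_weighted_ne_zero
    (h : ∀ m ∈ p.support, K ≤ a * m 0 + b * m 1) {k : ℕ}
    (hk : (slice (weighted a b K p)).coeff k ≠ 0) :
    ∃ m ∈ p.support, m 1 = k ∧ a * m 0 + b * m 1 = K := by
  rw [coeff_slice_weighted] at hk
  obtain ⟨m, hm, hmk⟩ := Finset.exists_ne_zero_of_sum_ne_zero hk
  obtain ⟨h0, h1⟩ := (ite_ne_right_iff.mp hmk).1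
  have h0 := Int.toNat_eq_zero.mp h0
  have := h m hm
  exact ⟨m, hm, h1, by linarith⟩

theorem coeff_of_rootMultiplicity_eq_natDegree {f : Polynomial ℂ} (hf : f ≠ 0) {c : ℂ}
    (h : f.rootMultiplicity c = f.natDegree) :
    ∃ r : ℂ, r ≠ 0 ∧
      ∀ k, f.coeff k = r * ((-c) ^ (f.natDegree - k) * (f.natDegree.choose k : ℂ)) := by
  obtain ⟨g, hg⟩ := Polynomial.pow_rootMultiplicity_dvd f c
  have hg0 : g ≠ 0 := by
    rintro rfl
    exact hf (by rw [hg, mul_zero])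
  have hd := congrArg Polynomial.natDegree hg
  rw [Polynomial.natDegree_mul (pow_ne_zero _ (Polynomial.X_sub_C_ne_zero c)) hg0, h,
    Polynomial.natDegree_pow, Polynomial.natDegree_X_sub_C] at hd
  obtain ⟨r, rfl⟩ := Polynomial.natDegree_eq_zero.mp (by lia : g.natDegree = 0)
  refine ⟨r, by simpa using hg0, fun k => ?_⟩
  conv_lhs => rw [hg, h, Polynomial.coeff_mul_C, sub_eq_add_neg,
    ← Polynomial.C_neg, Polynomial.coeff_X_add_C_pow]
  ring

variable {s n μ : ℕ}

theorem toNat_weight (s n j k K : ℕ) : ((s : ℤ) * j + n * k - K).toNat = s * j + n * k - K := by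
  rw [← Nat.cast_mul, ← Nat.cast_mul, ← Nat.cast_add, Int.toNat_sub]

theorem tendsto_weighted_term (hs : 0 < s) {j k : ℕ} (h : n * μ ≤ s * j + n * k)
    (hne : j ≠ 0 ∨ k ≠ μ) {τ w : ℕ → ℂ} (hτ : Tendsto τ atTop (nhds 0))
    (hw : Tendsto (fun i => ‖w i‖) atTop atTop)
    (hu : Tendsto (fun i => τ i ^ n * w i) atTop (nhds 0)) :
    Tendsto (fun i => τ i ^ (s * j + n * k - n * μ) * w i ^ k / w i ^ μ) atTop (nhds 0) := by
  have hw0 : ∀ᶠ i in atTop, w i ≠ 0 :=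
    (hw.eventually_gt_atTop 0).mono fun i hi => norm_pos_iff.mp hi
  rcases lt_or_ge k μ with hk | hk
  · have h1 : Tendsto (fun i => (w i ^ (μ - k))⁻¹) atTop (nhds 0) := by
      rw [tendsto_zero_iff_norm_tendsto_zero]
      simp only [norm_inv, norm_pow]
      exact tendsto_inv_atTop_zero.comp ((tendsto_pow_atTop (by lia)).comp hw)
    have h2 := (hτ.pow (s * j + n * k - n * μ)).mul h1
    rw [mul_zero] at h2
    refine h2.congr' (hw0.mono fun i hi => ?_)
    obtain ⟨d, rfl⟩ := Nat.exists_eq_add_of_lt hk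
    beta_reduce
    rw [show k + d + 1 - k = d + 1 by lia, show k + d + 1 = k + (d + 1) by ring, pow_add (w i) k]
    field_simp
  · obtain ⟨d, rfl⟩ := Nat.exists_eq_add_of_le hk
    have h1 := ((hτ.pow s).pow j).mul (hu.pow d)
    have h0 : ((0 : ℂ) ^ s) ^ j * 0 ^ d = 0 := by
      rw [zero_pow hs.ne']
      rcases hne with hj | hd
      · simp [hj]
      · have : d ≠ 0 := by lia
        simp [this]
    rw [h0] at h1
    refine h1.congr' (hw0.mono fun i hi => ?_)
    beta_reduce
    rw [show s * j + n * (μ + d) - n * μ = s * j + n * d by rw [mul_add]; lia, mul_pow, pow_add,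
      pow_add, pow_mul, pow_mul]
    field_simp

theorem tendsto_evalPoly_weighted_div (hs : 0 < s)
    (h : ∀ m ∈ p.support, n * μ ≤ s * m 0 + n * m 1) {τ w : ℕ → ℂ}
    (hτ : Tendsto τ atTop (nhds 0)) (hw : Tendsto (fun i => ‖w i‖) atTop atTop)
    (hu : Tendsto (fun i => τ i ^ n * w i) atTop (nhds 0)) :
    Tendsto (fun i => evalPoly (weighted s n (n * μ : ℕ) p) (τ i, w i) / w i ^ μ) atTop
      (nhds ((slice p).coeff μ)) := by
  simp only [evalPoly_weighted_eq_sum, toNat_weight, Finset.sum_div]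
  have : (slice p).coeff μ =
      ∑ m ∈ p.support, if m = Finsupp.single 1 μ then coeff m p else 0 := by
    rw [coeff_slice, Finset.sum_ite_eq']
    simp +contextual [eq_comm]
  rw [this]
  refine tendsto_finsetSum _ fun m hm => ?_
  split_ifs with hmμ
  · subst hmμ
    refine tendsto_const_nhds.congr' ?_
    filter_upwards [hw.eventually_gt_atTop 0] with i hi
    have := norm_pos_iff.mp hi
    simp [this]
  · have hne : m 0 ≠ 0 ∨ m 1 ≠ μ := by
      by_contra! hcon
      exact hmμ (by ext i; fin_cases i <;> simp [hcon.1, hcon.2])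
    have := (tendsto_weighted_term hs (h m hm) hne hτ hw hu).const_mul (coeff m p)
    rw [mul_zero] at this
    refine this.congr fun i => by ring

/-- The transformed second coordinate does not escape to infinity. -/
theorem not_tendsto_norm_atTop (hs : 0 < s) (hμ : 0 < μ) (hc : (slice p).coeff μ ≠ 0)
    (h : ∀ m ∈ p.support, n * μ ≤ s * m 0 + n * m 1) {τ w : ℕ → ℂ}
    (hτ : Tendsto τ atTop (nhds 0)) (hu : Tendsto (fun i => τ i ^ n * w i) atTop (nhds 0)) {z : ℂ}
    (hz : Tendsto (fun i => evalPoly (weighted s n (n * μ : ℕ) p) (τ i, w i)) atTop (nhds z)) :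
    ¬ Tendsto (fun i => ‖w i‖) atTop atTop := by
  intro hw
  have h1 := tendsto_evalPoly_weighted_div hs h hτ hw hu
  have h2 : Tendsto (fun i => (w i ^ μ)⁻¹) atTop (nhds 0) := by
    rw [tendsto_zero_iff_norm_tendsto_zero]
    simp only [norm_inv, norm_pow]
    exact tendsto_inv_atTop_zero.comp ((tendsto_pow_atTop hμ.ne').comp hw)
  have h3 := hz.mul h2
  rw [mul_zero] at h3
  exact hc (tendsto_nhds_unique h1 h3)

theorem tendsto_zero_of_pow {τ t : ℕ → ℂ} (h : ∀ i, τ i ^ s = t i)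
    (ht : Tendsto t atTop (nhds 0)) : Tendsto τ atTop (nhds 0) := by
  rw [Metric.tendsto_atTop] at ht ⊢
  intro ε hε
  obtain ⟨N, hN⟩ := ht (ε ^ s) (by positivity)
  refine ⟨N, fun i hi => ?_⟩
  have := hN i hi
  rw [dist_zero_right, ← h i, norm_pow] at this
  rw [dist_zero_right]
  exact lt_of_pow_lt_pow_left₀ s hε.le this

theorem evalPoly_pow_weighted {K : ℕ} (h : ∀ m ∈ p.support, K ≤ s * m 0 + n * m 1) {τ : ℂ}
    (hτ : τ ≠ 0) (w : ℂ) :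
    evalPoly p (τ ^ s, τ ^ n * w) = evalPoly (weighted s n K p) (τ, w) * τ ^ K := by
  have := evalPoly_weighted (p := p) (a := s) (b := n) (K := K)
    (fun m hm => by exact_mod_cast h m hm) hτ w
  simpa using this.symm

theorem evalPoly_pow_div {K A : ℕ} (h : ∀ m ∈ p.support, K ≤ s * m 0 + n * m 1) (hA : K ≤ s * A)
    {τ : ℂ} (hτ : τ ≠ 0) (w : ℂ) :
    evalPoly p (τ ^ s, τ ^ n * w) / (τ ^ s) ^ A =
      evalPoly (weighted s n K p) (τ, w) / τ ^ (s * A - K) := by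
  rw [evalPoly_pow_weighted h hτ, ← pow_mul, div_eq_div_iff (by positivity) (by positivity),
    mul_assoc, ← pow_add, Nat.add_sub_cancel' hA]

end NewtonSlope

section Germ

variable {p q : MvPolynomial (Fin 2) ℂ} {A B : ℕ} {c : ℂ} {a : ℂ × ℂ}

/-- `a` is a limit of `(t ^ (-A) * p, t ^ (-B) * q)` along the sequence `(t i, u i)`
with `t i → 0`. -/
structure LimitAlong (p q : MvPolynomial (Fin 2) ℂ) (A B : ℕ) (a : ℂ × ℂ) (t u : ℕ → ℂ) :
    Prop where
  ne_zero : ∀ i, t i ≠ 0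
  tendsto_t : Tendsto t atTop (nhds 0)
  tendsto_fst : Tendsto (fun i => evalPoly p (t i, u i) / t i ^ A) atTop (nhds a.1)
  tendsto_snd : Tendsto (fun i => evalPoly q (t i, u i) / t i ^ B) atTop (nhds a.2)

/-- A pair `(t ^ (-A) * p, t ^ (-B) * q)` of functions with poles along `t = 0`, which
tends to `a` along some sequence converging to `(0, c)`. -/
structure Germ (p q : MvPolynomial (Fin 2) ℂ) (A B : ℕ) (c : ℂ) (a : ℂ × ℂ) : Prop where
  A_pos : 0 < A
  B_pos : 0 < B
  jac : JacIndep p q A B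
  slice_left : slice p ≠ 0
  slice_right : slice q ≠ 0
  seq : ∃ t u, LimitAlong p q A B a t u ∧ Tendsto u atTop (nhds c)

/-- There is a polynomial curve through `a`, with degrees proportional to `(A, B)`, all of whose
points are limits of `(t ^ (-A) * p, t ^ (-B) * q)`. -/
def HasLimitCurve (p q : MvPolynomial (Fin 2) ℂ) (A B : ℕ) (a : ℂ × ℂ) : Prop :=
  ∃ α β : Polynomial ℂ, 0 < α.natDegree ∧ 0 < β.natDegree ∧ α.natDegree * B = β.natDegree * A ∧
    (∃ ξ, (α.eval ξ, β.eval ξ) = a) ∧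
    ∀ ξ, ∃ t u, LimitAlong p q A B (α.eval ξ, β.eval ξ) t u

theorem tendsto_evalPoly {t u : ℕ → ℂ} (ht : Tendsto t atTop (nhds 0))
    (hu : Tendsto u atTop (nhds c)) :
    Tendsto (fun i => evalPoly p (t i, u i)) atTop (nhds ((slice p).eval c)) := by
  rw [eval_slice]
  exact ((continuous_evalPoly p).tendsto (0, c)).comp (ht.prodMk_nhds hu)

theorem eval_slice_eq_zero_of_tendsto (hA : 0 < A) {t u : ℕ → ℂ} {z : ℂ} (h0 : ∀ i, t i ≠ 0)
    (ht : Tendsto t atTop (nhds 0)) (hu : Tendsto u atTop (nhds c))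
    (h : Tendsto (fun i => evalPoly p (t i, u i) / t i ^ A) atTop (nhds z)) :
    (slice p).eval c = 0 := by
  have h1 := h.mul (ht.pow A)
  rw [zero_pow hA.ne', mul_zero] at h1
  refine tendsto_nhds_unique (tendsto_evalPoly ht hu) (h1.congr fun i => ?_)
  have := h0 i
  field_simp

theorem Germ.eval_left (h : Germ p q A B c a) : (slice p).eval c = 0 := by
  obtain ⟨t, u, hl, hu⟩ := h.seq
  exact eval_slice_eq_zero_of_tendsto h.A_pos hl.ne_zero hl.tendsto_t hu hl.tendsto_fst

theorem Germ.eval_right (h : Germ p q A B c a) : (slice q).eval c = 0 := by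
  obtain ⟨t, u, hl, hu⟩ := h.seq
  exact eval_slice_eq_zero_of_tendsto h.B_pos hl.ne_zero hl.tendsto_t hu hl.tendsto_snd

theorem Germ.rootMultiplicity_left_pos (h : Germ p q A B c a) :
    0 < (slice p).rootMultiplicity c :=
  (Polynomial.rootMultiplicity_pos h.slice_left).mpr h.eval_left

theorem Germ.rootMultiplicity_right_pos (h : Germ p q A B c a) :
    0 < (slice q).rootMultiplicity c :=
  (Polynomial.rootMultiplicity_pos h.slice_right).mpr h.eval_right

theorem Germ.ratio (h : Germ p q A B c a) :
    A * (slice q).rootMultiplicity c = B * (slice p).rootMultiplicity c := by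
  exact_mod_cast h.jac.rootMultiplicity h.slice_left h.slice_right h.eval_left h.eval_right

theorem LimitAlong.of_shift {t u : ℕ → ℂ} (h : LimitAlong (shift c p) (shift c q) A B a t u) :
    LimitAlong p q A B a t (fun i => u i + c) where
  ne_zero := h.ne_zero
  tendsto_t := h.tendsto_t
  tendsto_fst := by simpa only [evalPoly_shift] using h.tendsto_fst
  tendsto_snd := by simpa only [evalPoly_shift] using h.tendsto_snd

theorem HasLimitCurve.of_shift (h : HasLimitCurve (shift c p) (shift c q) A B a) :
    HasLimitCurve p q A B a := by
  obtain ⟨α, β, h1, h2, h3, h4, h5⟩ := h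
  refine ⟨α, β, h1, h2, h3, h4, fun ξ => ?_⟩
  obtain ⟨t, u, h⟩ := h5 ξ
  exact ⟨t, _, h.of_shift⟩

theorem slice_shift_ne_zero (h : slice p ≠ 0) (c : ℂ) : slice (shift c p) ≠ 0 := by
  rw [slice_shift]
  exact fun h' => h (Polynomial.comp_X_add_C_eq_zero_iff.mp h')

theorem Germ.shift (h : Germ p q A B c a) : Germ (shift c p) (shift c q) A B 0 a where
  A_pos := h.A_pos
  B_pos := h.B_pos
  jac t ht u u' := by
    simpa only [twistedJac, pderiv_shift, evalPoly_shift] using h.jac t ht (u + c) (u' + c)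
  slice_left := slice_shift_ne_zero h.slice_left c
  slice_right := slice_shift_ne_zero h.slice_right c
  seq := by
    obtain ⟨t, u, hl, hu⟩ := h.seq
    refine ⟨t, fun i => u i - c, ⟨hl.ne_zero, hl.tendsto_t, ?_, ?_⟩, ?_⟩
    · simpa only [evalPoly_shift, sub_add_cancel] using hl.tendsto_fst
    · simpa only [evalPoly_shift, sub_add_cancel] using hl.tendsto_snd
    · simpa using hu.sub_const c

theorem rootMultiplicity_slice_shift (p : MvPolynomial (Fin 2) ℂ) (c : ℂ) :
    (slice (shift c p)).rootMultiplicity 0 = (slice p).rootMultiplicity c := by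
  rw [slice_shift, ← Polynomial.rootMultiplicity_eq_rootMultiplicity]

theorem coeff_slice_rootMultiplicity_ne_zero (h : slice p ≠ 0) :
    (slice p).coeff ((slice p).rootMultiplicity 0) ≠ 0 := by
  rw [Polynomial.rootMultiplicity_eq_natTrailingDegree']
  exact Polynomial.trailingCoeff_nonzero_iff_nonzero.mpr h

theorem exponent_pos {m : Fin 2 →₀ ℕ} (hm : m ∈ p.support)
    (hlt : m 1 < (slice p).rootMultiplicity 0) : 0 < m 0 := by
  rw [Polynomial.rootMultiplicity_eq_natTrailingDegree'] at hlt
  have h0 := Polynomial.coeff_eq_zero_of_lt_natTrailingDegree hlt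
  rw [coeff_slice] at h0
  by_contra! hm0
  have : Finsupp.single 1 (m 1) = m := by
    ext i; fin_cases i <;> simp_all
  rw [this] at h0
  exact (mem_support_iff.mp hm) h0

variable {s n : ℕ}

theorem natDegree_slice_weighted (hs : 0 < s) (hn : 0 < n) (hp : slice p ≠ 0)
    (h : ∀ m ∈ p.support, n * (slice p).rootMultiplicity 0 ≤ s * m 0 + n * m 1) :
    (slice (weighted s n (n * (slice p).rootMultiplicity 0 : ℕ) p)).natDegree =
        (slice p).rootMultiplicity 0 ∧
      slice (weighted s n (n * (slice p).rootMultiplicity 0 : ℕ) p) ≠ 0 := by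
  have hc := coeff_slice_rootMultiplicity_ne_zero hp
  set μ := (slice p).rootMultiplicity 0
  have h' : ∀ m ∈ p.support, ((n * μ : ℕ) : ℤ) ≤ s * m 0 + n * m 1 :=
    fun m hm => by exact_mod_cast h m hm
  have hmem : Finsupp.single 1 μ ∈ p.support := by rwa [mem_support_iff, ← coeff_slice]
  have h1 := coeff_slice_weighted_of_mem (by exact_mod_cast hs.ne') h' hmem (by simp)
  rw [← coeff_slice, Finsupp.single_eq_same] at h1
  refine ⟨le_antisymm ?_ (Polynomial.le_natDegree_of_ne_zero (h1 ▸ hc)), fun h0 => ?_⟩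
  · rw [Polynomial.natDegree_le_iff_coeff_eq_zero]
    intro N hN
    by_contra hne
    obtain ⟨m, -, rfl, hm⟩ := exists_mem_of_coeff_slice_weighted_ne_zero h' hne
    have hm : s * m 0 + n * m 1 = n * μ := by exact_mod_cast hm
    have : n * μ < n * m 1 := Nat.mul_lt_mul_of_pos_left hN hn
    lia
  · rw [h0, Polynomial.coeff_zero] at h1
    exact hc h1.symm

theorem exists_slope (h : Germ p q A B 0 a) :
    ∃ s n : ℕ, 0 < s ∧ 0 < n ∧ n.Coprime s ∧
      n * (slice p).rootMultiplicity 0 ≤ s * A ∧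
      (∀ m ∈ p.support, n * (slice p).rootMultiplicity 0 ≤ s * m 0 + n * m 1) ∧
      (∀ m ∈ q.support, n * (slice q).rootMultiplicity 0 ≤ s * m 0 + n * m 1) ∧
      (n * (slice p).rootMultiplicity 0 = s * A ∨
        (∃ m ∈ p.support, m 1 < (slice p).rootMultiplicity 0 ∧
          s * m 0 + n * m 1 = n * (slice p).rootMultiplicity 0) ∨
        (∃ m ∈ q.support, m 1 < (slice q).rootMultiplicity 0 ∧
          s * m 0 + n * m 1 = n * (slice q).rootMultiplicity 0)) := by
  have hμ := h.rootMultiplicity_left_pos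
  have hp := fun m => exponent_pos (p := p) (m := m)
  have hq := fun m => exponent_pos (p := q) (m := m)
  set μ := (slice p).rootMultiplicity 0
  set ν := (slice q).rootMultiplicity 0
  obtain ⟨s, n, hs, hn, hc, hle, hex⟩ := exists_min_slope
    (insert (A, μ) (((p.support.filter fun m => m 1 < μ).image fun m => (m 0, μ - m 1)) ∪
      (q.support.filter fun m => m 1 < ν).image fun m => (m 0, ν - m 1)))
    (Finset.insert_nonempty _ _) (by
      intro x hx
      simp only [Finset.mem_insert, Finset.mem_union, Finset.mem_image, Finset.mem_filter] at hx
      rcases hx with rfl | ⟨m, ⟨hm, hlt⟩, rfl⟩ | ⟨m, ⟨hm, hlt⟩, rfl⟩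
      · exact ⟨h.A_pos, hμ⟩
      · exact ⟨hp m hm hlt, Nat.sub_pos_of_lt hlt⟩
      · exact ⟨hq m hm hlt, Nat.sub_pos_of_lt hlt⟩)
  have hmul : ∀ {k l x : ℕ}, k < l → (n * (l - k) ≤ x ↔ n * l ≤ x + n * k) := by
    intro k l x hkl
    rw [Nat.mul_sub]
    lia
  refine ⟨s, n, hs, hn, hc, hle (A, μ) (Finset.mem_insert_self _ _), ?_, ?_, ?_⟩
  · intro m hm
    rcases lt_or_ge (m 1) μ with hlt | hge
    · refine (hmul hlt).mp (hle (m 0, μ - m 1) ?_)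
      simp only [Finset.mem_insert, Finset.mem_union, Finset.mem_image, Finset.mem_filter]
      exact Or.inr (Or.inl ⟨m, ⟨hm, hlt⟩, rfl⟩)
    · exact (Nat.mul_le_mul_left n hge).trans (Nat.le_add_left _ _)
  · intro m hm
    rcases lt_or_ge (m 1) ν with hlt | hge
    · refine (hmul hlt).mp (hle (m 0, ν - m 1) ?_)
      simp only [Finset.mem_insert, Finset.mem_union, Finset.mem_image, Finset.mem_filter]
      exact Or.inr (Or.inr ⟨m, ⟨hm, hlt⟩, rfl⟩)
    · exact (Nat.mul_le_mul_left n hge).trans (Nat.le_add_left _ _)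
  · obtain ⟨x, hx, hxe⟩ := hex
    simp only [Finset.mem_insert, Finset.mem_union, Finset.mem_image, Finset.mem_filter] at hx
    rcases hx with rfl | ⟨m, ⟨hm, hlt⟩, rfl⟩ | ⟨m, ⟨hm, hlt⟩, rfl⟩
    · exact Or.inl hxe
    · refine Or.inr (Or.inl ⟨m, hm, hlt, ?_⟩)
      have := Nat.mul_lt_mul_of_pos_left hlt hn
      rw [Nat.mul_sub] at hxe
      lia
    · refine Or.inr (Or.inr ⟨m, hm, hlt, ?_⟩)
      have := Nat.mul_lt_mul_of_pos_left hlt hn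
      rw [Nat.mul_sub] at hxe
      lia

theorem LimitAlong.of_weighted {K L : ℕ} (hs : 0 < s)
    (hp : ∀ m ∈ p.support, K ≤ s * m 0 + n * m 1) (hq : ∀ m ∈ q.support, L ≤ s * m 0 + n * m 1)
    (hA : K ≤ s * A) (hB : L ≤ s * B) {τ w : ℕ → ℂ}
    (h : LimitAlong (weighted s n K p) (weighted s n L q) (s * A - K) (s * B - L) a τ w) :
    LimitAlong p q A B a (fun i => τ i ^ s) (fun i => τ i ^ n * w i) where
  ne_zero i := pow_ne_zero _ (h.ne_zero i)
  tendsto_t := by simpa [hs.ne'] using h.tendsto_t.pow s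
  tendsto_fst := h.tendsto_fst.congr fun i => (evalPoly_pow_div hp hA (h.ne_zero i) _).symm
  tendsto_snd := h.tendsto_snd.congr fun i => (evalPoly_pow_div hq hB (h.ne_zero i) _).symm

theorem coeff_pred_ne_zero {f : Polynomial ℂ} (hf : f ≠ 0)
    (h : f.rootMultiplicity c = f.natDegree) (hc : c ≠ 0) : f.coeff (f.natDegree - 1) ≠ 0 := by
  obtain ⟨r, hr, hcoeff⟩ := coeff_of_rootMultiplicity_eq_natDegree hf h
  rw [hcoeff]
  have : (f.natDegree.choose (f.natDegree - 1) : ℂ) ≠ 0 := by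
    exact_mod_cast (Nat.choose_pos (Nat.sub_le _ _)).ne'
  have := neg_ne_zero.mpr hc
  positivity

theorem ne_zero_of_coeff_ne_zero {f : Polynomial ℂ} (hf : f ≠ 0)
    (h : f.rootMultiplicity c = f.natDegree) {k : ℕ} (hk : k < f.natDegree)
    (hne : f.coeff k ≠ 0) : c ≠ 0 := by
  rintro rfl
  obtain ⟨r, hr, hcoeff⟩ := coeff_of_rootMultiplicity_eq_natDegree hf h
  rw [hcoeff, neg_zero, zero_pow (Nat.sub_pos_of_lt hk).ne'] at hne
  simp at hne

/-- One step of the Newton-Puiseux process: either the limit curve is found, or the data can be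
replaced by data with a smaller multiplicity, or the same multiplicity and a smaller pole. -/
theorem Germ.step (h : Germ p q A B 0 a) :
    HasLimitCurve p q A B a ∨
      ∃ p' q' A' B' c', Germ p' q' A' B' c' a ∧
        (HasLimitCurve p' q' A' B' a → HasLimitCurve p q A B a) ∧
        ((slice p').rootMultiplicity c' < (slice p).rootMultiplicity 0 ∨
          (slice p').rootMultiplicity c' = (slice p).rootMultiplicity 0 ∧ A' < A) := by
  obtain ⟨s, n, hs, hn, hcop, hA, hp, hq, hex⟩ := exists_slope h
  have hμ := h.rootMultiplicity_left_pos
  have hν := h.rootMultiplicity_right_pos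
  have hratio := h.ratio
  obtain ⟨hdp, hp0⟩ := natDegree_slice_weighted hs hn h.slice_left hp
  obtain ⟨hdq, hq0⟩ := natDegree_slice_weighted hs hn h.slice_right hq
  have hcμ := coeff_slice_rootMultiplicity_ne_zero h.slice_left
  set μ := (slice p).rootMultiplicity 0
  set ν := (slice q).rootMultiplicity 0
  have hBν : (s * A - n * μ) * ν = (s * B - n * ν) * μ := by
    rw [Nat.sub_mul, Nat.sub_mul, mul_assoc, hratio]
    congr 1 <;> ring
  have hB : n * ν ≤ s * B := by
    refine Nat.le_of_mul_le_mul_right ?_ hμ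
    calc n * ν * μ = n * μ * ν := by ring
      _ ≤ s * A * ν := Nat.mul_le_mul_right _ hA
      _ = s * B * μ := by rw [mul_assoc, hratio]; ring
  set p' := weighted s n (n * μ : ℕ) p with hp'
  set q' := weighted s n (n * ν : ℕ) q with hq'
  obtain ⟨t, u, hl, hu⟩ := h.seq
  choose τ hτ using fun i => IsAlgClosed.exists_pow_nat_eq (t i) hs
  have hτ0 : ∀ i, τ i ≠ 0 := fun i h0 => hl.ne_zero i (by rw [← hτ i, h0, zero_pow hs.ne'])
  have hτt : Tendsto τ atTop (nhds 0) := tendsto_zero_of_pow hτ hl.tendsto_t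
  obtain ⟨w, hw⟩ : ∃ w : ℕ → ℂ, ∀ i, τ i ^ n * w i = u i :=
    ⟨fun i => u i / τ i ^ n, fun i => mul_div_cancel₀ _ (pow_ne_zero _ (hτ0 i))⟩
  have hl' : LimitAlong p' q' (s * A - n * μ) (s * B - n * ν) a τ w := by
    refine ⟨hτ0, hτt, hl.tendsto_fst.congr fun i => ?_, hl.tendsto_snd.congr fun i => ?_⟩
    · rw [← hτ i, ← hw i, evalPoly_pow_div hp hA (hτ0 i)]
    · rw [← hτ i, ← hw i, evalPoly_pow_div hq hB (hτ0 i)]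
  have hz : ∃ z, Tendsto (fun i => evalPoly p' (τ i, w i)) atTop (nhds z) :=
    ⟨_, (hl'.tendsto_fst.mul (hτt.pow (s * A - n * μ))).congr fun i =>
      div_mul_cancel₀ _ (pow_ne_zero _ (hτ0 i))⟩
  obtain ⟨z, hz⟩ := hz
  have hnot := not_tendsto_norm_atTop hs hμ hcμ hp hτt (by simpa only [hw] using hu) hz
  obtain ⟨R, hR⟩ : ∃ R, ∃ᶠ i in atTop, w i ∈ Metric.closedBall (0 : ℂ) R := by
    rw [tendsto_atTop] at hnot
    push Not at hnot
    obtain ⟨R, hR⟩ := hnot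
    exact ⟨R, hR.mono fun i hi => by simpa using hi.le⟩
  obtain ⟨c', -, φ, hφ, hwφ⟩ :=
    tendsto_subseq_of_frequently_bounded Metric.isBounded_closedBall hR
  have hl'' : LimitAlong p' q' (s * A - n * μ) (s * B - n * ν) a (τ ∘ φ) (w ∘ φ) :=
    ⟨fun i => hτ0 _, hτt.comp hφ.tendsto_atTop, hl'.tendsto_fst.comp hφ.tendsto_atTop,
      hl'.tendsto_snd.comp hφ.tendsto_atTop⟩
  rcases hA.eq_or_lt with hA0 | hApos
  · left
    have hB0 : s * B - n * ν = 0 := by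
      have : (s * B - n * ν) * μ = 0 := by rw [← hBν, hA0, Nat.sub_self, zero_mul]
      exact (Nat.mul_eq_zero.mp this).resolve_right hμ.ne'
    have hA0 : s * A - n * μ = 0 := by rw [hA0, Nat.sub_self]
    refine ⟨slice p', slice q', hdp ▸ hμ, hdq ▸ hν, ?_, ⟨c', ?_⟩, fun ξ => ?_⟩
    · rw [hdp, hdq]
      linarith
    · have h1 := hl''.tendsto_fst
      have h2 := hl''.tendsto_snd
      simp only [hA0, hB0, pow_zero, div_one] at h1 h2
      exact Prod.ext (tendsto_nhds_unique (tendsto_evalPoly hl''.tendsto_t hwφ) h1)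
        (tendsto_nhds_unique (tendsto_evalPoly hl''.tendsto_t hwφ) h2)
    · have : LimitAlong p' q' (s * A - n * μ) (s * B - n * ν)
          ((slice p').eval ξ, (slice q').eval ξ) τ fun _ => ξ := by
        refine ⟨hτ0, hτt, ?_, ?_⟩
        · simpa [hA0] using tendsto_evalPoly hτt tendsto_const_nhds
        · simpa [hB0] using tendsto_evalPoly hτt tendsto_const_nhds
      exact ⟨_, _, this.of_weighted hs hp hq hA hB⟩
  · right
    have hA' : 0 < s * A - n * μ := Nat.sub_pos_of_lt hApos
    have hB' : 0 < s * B - n * ν := by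
      refine Nat.pos_of_ne_zero fun h0 => ?_
      rw [h0, zero_mul] at hBν
      exact (Nat.mul_pos hA' hν).ne' hBν
    have hg : Germ p' q' (s * A - n * μ) (s * B - n * ν) c' a := by
      refine ⟨hA', hB', ?_, hp0, hq0, _, _, hl'', hwφ⟩
      have := h.jac.weighted (a := s) (b := n) (K := (n * μ : ℕ)) (L := (n * ν : ℕ))
        (fun m hm => by exact_mod_cast hp m hm) (fun m hm => by exact_mod_cast hq m hm)
      rw [Nat.cast_sub hA, Nat.cast_sub hB, Nat.cast_mul s, Nat.cast_mul s]
      exact this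
    refine ⟨p', q', _, _, c', hg, ?_, ?_⟩
    · rintro ⟨α, β, h1, h2, h3, h4, h5⟩
      refine ⟨α, β, h1, h2, ?_, h4, fun ξ => ?_⟩
      · have h6 : α.natDegree * ν = β.natDegree * μ := by
          refine Nat.eq_of_mul_eq_mul_right (Nat.mul_pos hA' hB') ?_
          calc α.natDegree * ν * ((s * A - n * μ) * (s * B - n * ν))
              = α.natDegree * (s * B - n * ν) * ((s * A - n * μ) * ν) := by ring
            _ = β.natDegree * μ * ((s * A - n * μ) * (s * B - n * ν)) := by rw [h3, hBν]; ring
        refine Nat.eq_of_mul_eq_mul_right hμ ?_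
        calc α.natDegree * B * μ = α.natDegree * (B * μ) := by ring
          _ = α.natDegree * ν * A := by rw [← hratio]; ring
          _ = β.natDegree * A * μ := by rw [h6]; ring
      · obtain ⟨t, u, h⟩ := h5 ξ
        exact ⟨_, _, h.of_weighted hs hp hq hA hB⟩
    · have hle : (slice p').rootMultiplicity c' ≤ μ := by
        rw [← hdp, ← Polynomial.count_roots]
        exact (Multiset.count_le_card _ _).trans (Polynomial.card_roots' _)
      refine hle.lt_or_eq.imp_right fun heq => ⟨heq, ?_⟩
      have hratio' := hg.ratio
      have heq' : (slice q').rootMultiplicity c' = ν := by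
        rw [heq, ← hBν] at hratio'
        exact Nat.eq_of_mul_eq_mul_left hA' hratio'
      have hpz : ∀ m ∈ p.support, ((n * μ : ℕ) : ℤ) ≤ s * m 0 + n * m 1 :=
        fun m hm => by exact_mod_cast hp m hm
      have hqz : ∀ m ∈ q.support, ((n * ν : ℕ) : ℤ) ≤ s * m 0 + n * m 1 :=
        fun m hm => by exact_mod_cast hq m hm
      have hsz : (s : ℤ) ≠ 0 := by exact_mod_cast hs.ne'
      have hc' : c' ≠ 0 := by
        rcases hex with he | ⟨m, hm, hlt, he⟩ | ⟨m, hm, hlt, he⟩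
        · exact absurd he hApos.ne
        · refine ne_zero_of_coeff_ne_zero hp0 (heq.trans hdp.symm) (k := m 1) (hdp.symm ▸ hlt) ?_
          rw [hp', coeff_slice_weighted_of_mem hsz hpz hm (by exact_mod_cast he)]
          exact mem_support_iff.mp hm
        · refine ne_zero_of_coeff_ne_zero hq0 (heq'.trans hdq.symm) (k := m 1) (hdq.symm ▸ hlt) ?_
          rw [hq', coeff_slice_weighted_of_mem hsz hqz hm (by exact_mod_cast he)]
          exact mem_support_iff.mp hm
      have hpred := coeff_pred_ne_zero hp0 (heq.trans hdp.symm) hc'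
      rw [hdp] at hpred
      obtain ⟨m, hm, hm1, he⟩ := exists_mem_of_coeff_slice_weighted_ne_zero hpz hpred
      have he : s * m 0 + n * m 1 = n * μ := by exact_mod_cast he
      obtain ⟨d, hd⟩ := Nat.exists_eq_succ_of_ne_zero hμ.ne'
      have hsn : s * m 0 = n := by
        rw [hm1, hd, Nat.succ_sub_one, Nat.succ_eq_add_one, mul_add] at he
        lia
      have hs1 : s = 1 := by
        rw [Nat.coprime_comm] at hcop
        exact Nat.eq_one_of_dvd_coprimes hcop dvd_rfl ⟨_, hsn.symm⟩
      rw [hs1, one_mul]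
      exact Nat.sub_lt h.A_pos (Nat.mul_pos hn hμ)

theorem Germ.hasLimitCurve (h : Germ p q A B c a) : HasLimitCurve p q A B a := by
  obtain ⟨k, hk⟩ : ∃ k, (slice p).rootMultiplicity c = k := ⟨_, rfl⟩
  induction k using Nat.strong_induction_on generalizing p q A B c with
  | _ k ihk =>
    induction A using Nat.strong_induction_on generalizing p q B c with
    | _ A ihA =>
      refine HasLimitCurve.of_shift (c := c) ?_
      rcases h.shift.step with h' | ⟨p', q', A', B', c', hg, himp, hlt⟩
      · exact h'
      · rw [rootMultiplicity_slice_shift, hk] at hlt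
        rcases hlt with hlt | ⟨heq, hlt⟩
        · exact himp (ihk _ hlt hg rfl)
        · exact himp (ihA _ hlt hg heq)

end Germ

section Keller

variable {P Q : MvPolynomial (Fin 2) ℂ} {a : ℂ × ℂ}

/-- There is a polynomial curve through `a` inside the non-proper value set of `(P, Q)`, with
degrees proportional to those of `(P, Q)`. -/
def HasNonProperCurve (P Q : MvPolynomial (Fin 2) ℂ) (a : ℂ × ℂ) : Prop :=
  ∃ α β : Polynomial ℂ,
    0 < α.natDegree ∧ 0 < β.natDegree ∧
    a ∈ Set.range (fun t : ℂ => (α.eval t, β.eval t)) ∧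
    Set.range (fun t : ℂ => (α.eval t, β.eval t)) ⊆ nonProperSet (polyMap P Q) ∧
    α.natDegree * Q.totalDegree = β.natDegree * P.totalDegree

theorem neg_totalDegree_le (P : MvPolynomial (Fin 2) ℂ) :
    ∀ m ∈ P.support, -(P.totalDegree : ℤ) ≤ (-1) * m 0 + (-1) * m 1 := by
  intro m hm
  have := le_totalDegree hm
  rw [Finsupp.sum_fintype _ _ (by simp), Fin.sum_univ_two] at this
  lia

theorem slice_weighted_totalDegree_ne_zero (h : P ≠ 0) :
    slice (weighted (-1) (-1) (-P.totalDegree) P) ≠ 0 := by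
  obtain ⟨m, hm, hmd⟩ := Finset.exists_mem_eq_sup P.support (support_nonempty.mpr h)
    fun s => s.sum fun _ e => e
  rw [Finsupp.sum_fintype _ _ (by simp), Fin.sum_univ_two] at hmd
  have hd : P.totalDegree = m 0 + m 1 := hmd
  intro h0
  have h1 := coeff_slice_weighted_of_mem (by norm_num) (neg_totalDegree_le P) hm
    (by rw [hd]; push_cast; ring)
  rw [h0, Polynomial.coeff_zero] at h1
  exact mem_support_iff.mp hm h1.symm

theorem evalPoly_weighted_totalDegree_div (P : MvPolynomial (Fin 2) ℂ) {τ : ℂ} (hτ : τ ≠ 0)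
    (w : ℂ) :
    evalPoly (weighted (-1) (-1) (-P.totalDegree) P) (τ, w) / τ ^ P.totalDegree =
      evalPoly P (τ⁻¹, τ⁻¹ * w) := by
  simpa [div_eq_mul_inv] using evalPoly_weighted (neg_totalDegree_le P) hτ w

theorem IsKeller.jacIndep (hK : IsKeller P Q) : JacIndep P Q 0 0 := by
  obtain ⟨c, -, hc⟩ := hK
  have h : ∀ x y, twistedJac P Q 0 0 x y = x * c := fun x y => by
    have := congrArg (fun R => evalPoly R (x, y)) hc
    simp only [evalPoly, map_sub, map_mul, eval_C] at this
    simp only [twistedJac, evalPoly]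
    rw [← this]
    push_cast
    ring
  exact fun x _ y y' => by rw [h, h]

theorem IsKeller.totalDegree_pos_left (hK : IsKeller P Q) : 0 < P.totalDegree := by
  obtain ⟨c, hc0, hc⟩ := hK
  refine Nat.pos_of_ne_zero fun h => hc0 ?_
  rw [totalDegree_eq_zero_iff_eq_C.mp h] at hc
  simpa using hc.symm

theorem IsKeller.totalDegree_pos_right (hK : IsKeller P Q) : 0 < Q.totalDegree := by
  obtain ⟨c, hc0, hc⟩ := hK
  refine Nat.pos_of_ne_zero fun h => hc0 ?_
  rw [totalDegree_eq_zero_iff_eq_C.mp h] at hc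
  simpa using hc.symm

theorem IsKeller.hasNonProperCurve_of_norm_le (hK : IsKeller P Q) {b : ℕ → ℂ × ℂ}
    (hb : Tendsto (fun i => ‖b i‖) atTop atTop)
    (ha : Tendsto (fun i => polyMap P Q (b i)) atTop (nhds a))
    (hle : ∀ i, ‖(b i).2‖ ≤ ‖(b i).1‖) (h0 : ∀ i, (b i).1 ≠ 0) : HasNonProperCurve P Q a := by
  have hP := hK.totalDegree_pos_left
  have hQ := hK.totalDegree_pos_right
  have ht : Tendsto (fun i => (b i).1⁻¹) atTop (nhds 0) := by
    rw [tendsto_zero_iff_norm_tendsto_zero]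
    refine (tendsto_inv_atTop_zero.comp hb).congr fun i => ?_
    simp [Prod.norm_def, hle i]
  have hball : ∀ i, (b i).2 / (b i).1 ∈ Metric.closedBall (0 : ℂ) 1 := fun i => by
    simpa using div_le_one_of_le₀ (hle i) (norm_nonneg _)
  obtain ⟨c, -, φ, hφ, hc⟩ := tendsto_subseq_of_bounded Metric.isBounded_closedBall hball
  have hseq : ∀ (R : MvPolynomial (Fin 2) ℂ) i,
      evalPoly (weighted (-1) (-1) (-R.totalDegree) R) ((b i).1⁻¹, (b i).2 / (b i).1) /
        (b i).1⁻¹ ^ R.totalDegree = evalPoly R (b i) := fun R i => by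
    rw [evalPoly_weighted_totalDegree_div R (inv_ne_zero (h0 i)), inv_inv,
      mul_div_cancel₀ _ (h0 i)]
  have hg : Germ (weighted (-1) (-1) (-P.totalDegree) P) (weighted (-1) (-1) (-Q.totalDegree) Q)
      P.totalDegree Q.totalDegree c a := by
    refine ⟨hP, hQ, ?_, ?_, ?_, fun i => (b (φ i)).1⁻¹, fun i => (b (φ i)).2 / (b (φ i)).1,
      ⟨fun i => inv_ne_zero (h0 _), ht.comp hφ.tendsto_atTop, ?_, ?_⟩, hc⟩
    · simpa using hK.jacIndep.weighted (neg_totalDegree_le P) (neg_totalDegree_le Q)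
    · exact slice_weighted_totalDegree_ne_zero (by rintro rfl; simp at hP)
    · exact slice_weighted_totalDegree_ne_zero (by rintro rfl; simp at hQ)
    · simp only [hseq]
      exact ((continuous_fst.tendsto a).comp ha).comp hφ.tendsto_atTop
    · simp only [hseq]
      exact ((continuous_snd.tendsto a).comp ha).comp hφ.tendsto_atTop
  obtain ⟨α, β, h1, h2, h3, ⟨ξ, hξ⟩, h5⟩ := hg.hasLimitCurve
  refine ⟨α, β, h1, h2, ⟨ξ, hξ⟩, ?_, h3⟩
  rintro _ ⟨ξ, rfl⟩
  obtain ⟨t, u, hl⟩ := h5 ξ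
  refine ⟨fun i => ((t i)⁻¹, (t i)⁻¹ * u i), ?_, ?_⟩
  · have : Tendsto (fun i => ‖(t i)⁻¹‖) atTop atTop :=
      tendsto_norm_inv_nhdsNE_zero_atTop.comp
        (tendsto_nhdsWithin_iff.mpr ⟨hl.tendsto_t, Eventually.of_forall hl.ne_zero⟩)
    exact tendsto_atTop_mono (fun i => le_max_left _ _) this
  · have h6 := hl.tendsto_fst
    have h7 := hl.tendsto_snd
    simp only [evalPoly_weighted_totalDegree_div _ (hl.ne_zero _)] at h6 h7
    exact h6.prodMk_nhds h7

/-- The polynomial `P (y, x)`. -/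
noncomputable def swapVars (P : MvPolynomial (Fin 2) ℂ) : MvPolynomial (Fin 2) ℂ :=
  renameEquiv ℂ (Equiv.swap 0 1) P

theorem evalPoly_swapVars (P : MvPolynomial (Fin 2) ℂ) (x : ℂ × ℂ) :
    evalPoly (swapVars P) x = evalPoly P x.swap := by
  rw [evalPoly, evalPoly, swapVars, renameEquiv_apply, eval_rename]
  congr 2
  ext i
  fin_cases i <;> simp

theorem polyMap_swapVars (P Q : MvPolynomial (Fin 2) ℂ) (x : ℂ × ℂ) :
    polyMap (swapVars P) (swapVars Q) x = polyMap P Q x.swap := by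
  simp only [polyMap, evalPoly_swapVars]

theorem norm_swap (x : ℂ × ℂ) : ‖x.swap‖ = ‖x‖ := max_comm _ _

theorem pderiv_swapVars (P : MvPolynomial (Fin 2) ℂ) (i : Fin 2) :
    pderiv (Equiv.swap 0 1 i) (swapVars P) = swapVars (pderiv i P) :=
  pderiv_rename (Equiv.injective _) i P

theorem IsKeller.swapVars (hK : IsKeller P Q) : IsKeller (swapVars P) (swapVars Q) := by
  obtain ⟨c, hc0, hc⟩ := hK
  refine ⟨-c, neg_ne_zero.mpr hc0, ?_⟩
  have h0 : ∀ R, pderiv 0 (_root_.swapVars R) = _root_.swapVars (pderiv 1 R) := fun R => by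
    simpa using pderiv_swapVars R 1
  have h1 : ∀ R, pderiv 1 (_root_.swapVars R) = _root_.swapVars (pderiv 0 R) := fun R => by
    simpa using pderiv_swapVars R 0
  have h2 := congrArg _root_.swapVars hc
  simp only [h0, h1]
  simp only [_root_.swapVars, map_sub, map_mul, renameEquiv_apply, rename_C, map_neg] at h2 ⊢
  linear_combination -h2

theorem HasNonProperCurve.of_swapVars (h : HasNonProperCurve (swapVars P) (swapVars Q) a) :
    HasNonProperCurve P Q a := by
  obtain ⟨α, β, h1, h2, h3, h4, h5⟩ := h
  refine ⟨α, β, h1, h2, h3, h4.trans ?_, ?_⟩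
  · rintro x ⟨b, hb, hx⟩
    exact ⟨fun i => (b i).swap, by simpa only [norm_swap] using hb,
      by simpa only [polyMap_swapVars] using hx⟩
  · simpa only [swapVars, totalDegree_renameEquiv] using h5

theorem IsKeller.hasNonProperCurve_of_frequently (hK : IsKeller P Q) {b : ℕ → ℂ × ℂ}
    (hb : Tendsto (fun i => ‖b i‖) atTop atTop)
    (ha : Tendsto (fun i => polyMap P Q (b i)) atTop (nhds a))
    (hle : ∃ᶠ i in atTop, ‖(b i).2‖ ≤ ‖(b i).1‖) : HasNonProperCurve P Q a := by
  obtain ⟨φ, hφ, h⟩ := extraction_of_frequently_atTop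
    (hle.and_eventually (hb.eventually_gt_atTop 0))
  refine hK.hasNonProperCurve_of_norm_le (hb.comp hφ.tendsto_atTop) (ha.comp hφ.tendsto_atTop)
    (fun i => (h i).1) fun i h0 => ?_
  obtain ⟨h1, h2⟩ := h i
  rw [Prod.norm_def, max_eq_left h1, h0, norm_zero] at h2
  exact lt_irrefl _ h2

theorem IsKeller.hasNonProperCurve (hK : IsKeller P Q) (h : a ∈ nonProperSet (polyMap P Q)) :
    HasNonProperCurve P Q a := by
  obtain ⟨b, hb, ha⟩ := h
  have : ∃ᶠ i in atTop, ‖(b i).2‖ ≤ ‖(b i).1‖ ∨ ‖(b i).1‖ ≤ ‖(b i).2‖ :=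
    Frequently.of_forall fun i => le_total _ _
  rcases frequently_or_distrib.mp this with h | h
  · exact hK.hasNonProperCurve_of_frequently hb ha h
  · refine (hK.swapVars.hasNonProperCurve_of_frequently (b := fun i => (b i).swap) ?_ ?_
      h).of_swapVars
    · simpa only [norm_swap] using hb
    · simpa only [polyMap_swapVars, Prod.swap_swap] using ha

end Keller

/-- for a non-proper Keller map, the non-proper value set is nonempty
and every point of it lies on a polynomially parametrized curve contained in it,
whose parametrization `(α, β)` satisfies `deg α / deg β = deg P / deg Q`. -/
theorem keller_nonProperSet_structure
    (P Q : MvPolynomial (Fin 2) ℂ) (hK : IsKeller P Q)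
    (hnp : ∃ b : ℕ → ℂ × ℂ, Tendsto (fun i => ‖b i‖) atTop atTop ∧
      ∃ a : ℂ × ℂ, Tendsto (fun i => polyMap P Q (b i)) atTop (nhds a)) :
    (nonProperSet (polyMap P Q)).Nonempty ∧
    ∀ a ∈ nonProperSet (polyMap P Q), ∃ α β : Polynomial ℂ,
      0 < α.natDegree ∧ 0 < β.natDegree ∧
      a ∈ Set.range (fun t : ℂ => (α.eval t, β.eval t)) ∧
      Set.range (fun t : ℂ => (α.eval t, β.eval t)) ⊆ nonProperSet (polyMap P Q) ∧
      α.natDegree * Q.totalDegree = β.natDegree * P.totalDegree := by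
  obtain ⟨b, hb, a, ha⟩ := hnp
  exact ⟨⟨a, b, hb, ha⟩, fun a ha => hK.hasNonProperCurve ha⟩
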